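/- Let T>0, let b∈C¹([0,T]) be nonnegative and bounded, let a∈𝒢^s(ℝ) (s>1) be nonnegative, let 0≤δ<1 and 0<μ≤1. Define F(t,x,ξ) = 2|b'(t)|·φ(x,ξ)·(b(t)a(x)+⟨ξ⟩_μ^{-2δ}) − b'(t)·a(x)·b(t)·φ(x,ξ) − ⟨ξ⟩_μ^{-2δ}·b'(t)·a(x). Then for every k,l∈ℕ there exists C_{kl}>0, independent of t∈[0,T] and of μ∈(0,1], such that for every t with b'(t)≠0 and all x,ξ∈ℝ: |∂_x^{k}∂_ξ^{l}( ( |b'(t)|^{-1}·φ(x,ξ)^{-1}·F(t,x,ξ) / (b(t)φ(x,ξ)+⟨ξ⟩_μ^{-2δ}) )^{1/2} )| ≤ C_{kl}·φ(x,ξ)^{-k/2}·⟨ξ⟩_μ^{-l}. -/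

import Mathlib

open scoped ContDiff

open Set

/-- `⟨ξ⟩_μ = (μ⁻² + ξ²)^(1/2)` -/
noncomputable def br (μ ξ : ℝ) : ℝ := Real.sqrt (μ⁻¹ ^ 2 + ξ ^ 2)

/-- `φ(x,ξ) = a(x) + ⟨ξ⟩_μ^(-2δ)` -/
noncomputable def phi (a : ℝ → ℝ) (δ μ x ξ : ℝ) : ℝ := a x + br μ ξ ^ (-(2*δ))

/-- Gevrey class `𝒢^s(ℝ)` -/
def Gevrey (s : ℝ) (a : ℝ → ℝ) : Prop :=
  ContDiff ℝ ∞ a ∧ ∃ C₀ A₀ : ℝ, 0 < C₀ ∧ 0 < A₀ ∧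
    ∀ (x : ℝ) (k : ℕ), |iteratedDeriv k a x| ≤ C₀ * A₀ ^ k * (k.factorial : ℝ) ^ s

/-- `∂_x^k ∂_ξ^l f(x,ξ)` -/
noncomputable def pdXxi (k l : ℕ) (f : ℝ → ℝ → ℝ) (x ξ : ℝ) : ℝ :=
  iteratedDeriv k (fun x' => iteratedDeriv l (f x') ξ) x

/-- `F(t,x,ξ) = 2|b'(t)| φ (b(t)a(x)+⟨ξ⟩_μ^{-2δ}) − b'(t) a(x) b(t) φ − ⟨ξ⟩_μ^{-2δ} b'(t) a(x)`,
with `b'` the derivative of `b` within `[0,T]`. -/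
noncomputable def Ffun (b a : ℝ → ℝ) (T δ μ t x ξ : ℝ) : ℝ :=
  2 * |derivWithin b (Icc 0 T) t| * phi a δ μ x ξ * (b t * a x + br μ ξ ^ (-(2*δ)))
    - derivWithin b (Icc 0 T) t * a x * b t * phi a δ μ x ξ
    - br μ ξ ^ (-(2*δ)) * derivWithin b (Icc 0 T) t * a x


/-- Symbols of order `m`, up to `n` derivatives, uniformly in the parameter `i`. -/
def Sy {ι : Type} (p q : ι → ℝ → ℝ → ℝ) : ℕ → (ι → ℝ → ℝ → ℝ) → (ι → ℝ → ℝ → ℝ) → Prop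
  | 0, f, m => ∃ C : ℝ, 0 ≤ C ∧ ∀ i x ξ, |f i x ξ| ≤ C * m i x ξ
  | n+1, f, m => (∃ C : ℝ, 0 ≤ C ∧ ∀ i x ξ, |f i x ξ| ≤ C * m i x ξ) ∧
      (∃ g, (∀ i x ξ, HasDerivAt (fun y => f i y ξ) (g i x ξ) x) ∧ Sy p q n g (m * p)) ∧
      (∃ g, (∀ i x ξ, HasDerivAt (fun y => f i x y) (g i x ξ) ξ) ∧ Sy p q n g (m * q))

section
variable {ι : Type} {p q : ι → ℝ → ℝ → ℝ}

theorem Sy.bd {n : ℕ} {f m : ι → ℝ → ℝ → ℝ} (h : Sy p q n f m) :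
    ∃ C : ℝ, 0 ≤ C ∧ ∀ i x ξ, |f i x ξ| ≤ C * m i x ξ := by
  cases n with
  | zero => exact h
  | succ n => exact h.1

theorem Sy.down {n : ℕ} {f m : ι → ℝ → ℝ → ℝ} (h : Sy p q (n+1) f m) : Sy p q n f m := by
  induction n generalizing f m with
  | zero => exact h.1
  | succ n ih =>
    obtain ⟨h0, ⟨g, hg, hg'⟩, ⟨k, hk, hk'⟩⟩ := h
    exact ⟨h0, ⟨g, hg, ih hg'⟩, ⟨k, hk, ih hk'⟩⟩

theorem Sy.mono (hp : 0 ≤ p) (hq : 0 ≤ q) {n : ℕ} {f m m' : ι → ℝ → ℝ → ℝ} (h : Sy p q n f m)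
    (K : ℝ) (hK : 0 ≤ K) (hm : ∀ i x ξ, m i x ξ ≤ K * m' i x ξ) : Sy p q n f m' := by
  have aux : ∀ {f m m' : ι → ℝ → ℝ → ℝ}, (∀ i x ξ, m i x ξ ≤ K * m' i x ξ) →
      (∃ C : ℝ, 0 ≤ C ∧ ∀ i x ξ, |f i x ξ| ≤ C * m i x ξ) →
      ∃ C : ℝ, 0 ≤ C ∧ ∀ i x ξ, |f i x ξ| ≤ C * m' i x ξ := by
    rintro f m m' hm ⟨C, hC, h⟩
    refine ⟨C * K, by positivity, fun i x ξ => (h i x ξ).trans ?_⟩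
    rw [mul_assoc]
    exact mul_le_mul_of_nonneg_left (hm i x ξ) hC
  induction n generalizing f m m' with
  | zero => exact aux hm h
  | succ n ih =>
    obtain ⟨h0, ⟨g, hg, hg'⟩, ⟨k, hk, hk'⟩⟩ := h
    refine ⟨aux hm h0, ⟨g, hg, ih hg' ?_⟩, ⟨k, hk, ih hk' ?_⟩⟩
    · intro i x ξ
      have := mul_le_mul_of_nonneg_right (hm i x ξ) (hp i x ξ)
      simpa [mul_assoc] using this
    · intro i x ξ
      have := mul_le_mul_of_nonneg_right (hm i x ξ) (hq i x ξ)
      simpa [mul_assoc] using this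

theorem Sy.congr {n : ℕ} {f f' m m' : ι → ℝ → ℝ → ℝ} (h : Sy p q n f m)
    (hf : ∀ i x ξ, f' i x ξ = f i x ξ) (hm : ∀ i x ξ, m i x ξ = m' i x ξ) : Sy p q n f' m' := by
  have e1 : f' = f := by funext i x ξ; exact hf i x ξ
  have e2 : m = m' := by funext i x ξ; exact hm i x ξ
  rw [e1, ← e2]; exact h

theorem Sy.zero (hp : 0 ≤ p) (hq : 0 ≤ q) {n : ℕ} {m : ι → ℝ → ℝ → ℝ} (hm : 0 ≤ m) :
    Sy p q n 0 m := by
  have aux : ∀ {m : ι → ℝ → ℝ → ℝ}, 0 ≤ m → ∃ C : ℝ, 0 ≤ C ∧ ∀ i x ξ,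
      |(0 : ι → ℝ → ℝ → ℝ) i x ξ| ≤ C * m i x ξ := by
    intro m hm
    exact ⟨0, le_rfl, fun i x ξ => by simp⟩
  induction n generalizing m with
  | zero => exact aux hm
  | succ n ih =>
    exact ⟨aux hm, ⟨0, fun i x ξ => hasDerivAt_const x 0, ih (mul_nonneg hm hp)⟩,
      ⟨0, fun i x ξ => hasDerivAt_const ξ 0, ih (mul_nonneg hm hq)⟩⟩

theorem Sy.const (hp : 0 ≤ p) (hq : 0 ≤ q) {n : ℕ} {m : ι → ℝ → ℝ → ℝ} (hm : 0 ≤ m) (c : ι → ℝ)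
    (C : ℝ) (hC : 0 ≤ C) (h : ∀ i x ξ, |c i| ≤ C * m i x ξ) :
    Sy p q n (fun i _ _ => c i) m := by
  cases n with
  | zero => exact ⟨C, hC, h⟩
  | succ n =>
    exact ⟨⟨C, hC, h⟩, ⟨0, fun i x ξ => hasDerivAt_const x _, Sy.zero hp hq (mul_nonneg hm hp)⟩,
      ⟨0, fun i x ξ => hasDerivAt_const ξ _, Sy.zero hp hq (mul_nonneg hm hq)⟩⟩

theorem Sy.add {n : ℕ} {f g m : ι → ℝ → ℝ → ℝ} (h : Sy p q n f m) (h' : Sy p q n g m) :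
    Sy p q n (f + g) m := by
  have aux : ∀ {f g m : ι → ℝ → ℝ → ℝ}, (∃ C : ℝ, 0 ≤ C ∧ ∀ i x ξ, |f i x ξ| ≤ C * m i x ξ) →
      (∃ C : ℝ, 0 ≤ C ∧ ∀ i x ξ, |g i x ξ| ≤ C * m i x ξ) →
      ∃ C : ℝ, 0 ≤ C ∧ ∀ i x ξ, |(f + g) i x ξ| ≤ C * m i x ξ := by
    rintro f g m ⟨C, hC, h⟩ ⟨D, hD, h'⟩
    refine ⟨C + D, by positivity, fun i x ξ => (abs_add_le _ _).trans ?_⟩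
    rw [add_mul]
    exact add_le_add (h i x ξ) (h' i x ξ)
  induction n generalizing f g m with
  | zero => exact aux h h'
  | succ n ih =>
    obtain ⟨h0, ⟨u, hu, hu'⟩, ⟨k, hk, hk'⟩⟩ := h
    obtain ⟨i0, ⟨v, hv, hv'⟩, ⟨l, hl, hl'⟩⟩ := h'
    exact ⟨aux h0 i0, ⟨u + v, fun i x ξ => (hu i x ξ).add (hv i x ξ), ih hu' hv'⟩,
      ⟨k + l, fun i x ξ => (hk i x ξ).add (hl i x ξ), ih hk' hl'⟩⟩

theorem Sy.mul {n : ℕ} {f g m m' : ι → ℝ → ℝ → ℝ} (h : Sy p q n f m) (h' : Sy p q n g m') :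
    Sy p q n (f * g) (m * m') := by
  have aux : ∀ {f g m m' : ι → ℝ → ℝ → ℝ}, (∃ C : ℝ, 0 ≤ C ∧ ∀ i x ξ, |f i x ξ| ≤ C * m i x ξ) →
      (∃ C : ℝ, 0 ≤ C ∧ ∀ i x ξ, |g i x ξ| ≤ C * m' i x ξ) →
      ∃ C : ℝ, 0 ≤ C ∧ ∀ i x ξ, |(f * g) i x ξ| ≤ C * (m * m') i x ξ := by
    rintro f g m m' ⟨C, hC, h⟩ ⟨D, hD, h'⟩
    refine ⟨C * D, by positivity, fun i x ξ => ?_⟩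
    have := mul_le_mul (h i x ξ) (h' i x ξ) (abs_nonneg _) ((abs_nonneg _).trans (h i x ξ))
    rw [← abs_mul] at this
    refine this.trans (le_of_eq ?_)
    simp only [Pi.mul_apply]; ring
  induction n generalizing f g m m' with
  | zero => exact aux h h'
  | succ n ih =>
    have hd := h.down
    have hd' := h'.down
    obtain ⟨h0, ⟨u, hu, hu'⟩, ⟨k, hk, hk'⟩⟩ := h
    obtain ⟨i0, ⟨v, hv, hv'⟩, ⟨l, hl, hl'⟩⟩ := h'
    refine ⟨aux h0 i0, ⟨u * g + f * v, fun i x ξ => (hu i x ξ).mul (hv i x ξ), ?_⟩,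
      ⟨k * g + f * l, fun i x ξ => (hk i x ξ).mul (hl i x ξ), ?_⟩⟩
    · refine Sy.add ((ih hu' hd').congr (fun _ _ _ => rfl) ?_)
        ((ih hd hv').congr (fun _ _ _ => rfl) ?_) <;>
      · intro i x ξ; simp only [Pi.mul_apply]; ring
    · refine Sy.add ((ih hk' hd').congr (fun _ _ _ => rfl) ?_)
        ((ih hd hl').congr (fun _ _ _ => rfl) ?_) <;>
      · intro i x ξ; simp only [Pi.mul_apply]; ring

theorem Sy.smul (hp : 0 ≤ p) (hq : 0 ≤ q) {n : ℕ} {f m : ι → ℝ → ℝ → ℝ} (h : Sy p q n f m)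
    (c : ι → ℝ) (C : ℝ) (hc : ∀ i, |c i| ≤ C) :
    Sy p q n (fun i x ξ => c i * f i x ξ) m := by
  have h1 : Sy p q n (fun i _ _ => c i) 1 := by
    refine Sy.const hp hq ?_ c (max C 0) (le_max_right _ _) ?_
    · intro i x ξ; simp
    · intro i x ξ
      simpa using Or.inl (hc i)
  exact (h1.mul h).congr (fun _ _ _ => rfl) (fun i x ξ => by simp)

theorem Sy.inv {n : ℕ} {f m : ι → ℝ → ℝ → ℝ}
    (hp : 0 ≤ p) (hq : 0 ≤ q) (h : Sy p q n f m)
    (hm : ∀ i x ξ, 0 < m i x ξ) (K : ℝ) (hK : 0 < K)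
    (hf : ∀ i x ξ, m i x ξ ≤ K * f i x ξ) : Sy p q n (f⁻¹) (m⁻¹) := by
  have hfp : ∀ i x ξ, 0 < f i x ξ := fun i x ξ =>
    pos_of_mul_pos_right ((hm i x ξ).trans_le (hf i x ξ)) hK.le
  have aux : ∃ C : ℝ, 0 ≤ C ∧ ∀ i x ξ, |f⁻¹ i x ξ| ≤ C * m⁻¹ i x ξ := by
    refine ⟨K, hK.le, fun i x ξ => ?_⟩
    have h1 := hm i x ξ
    have h2 := hfp i x ξ
    simp only [Pi.inv_apply]
    rw [abs_of_pos (inv_pos.2 h2), ← div_eq_mul_inv, le_div_iff₀ h1, inv_mul_le_iff₀ h2, mul_comm]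
    exact hf i x ξ
  induction n with
  | zero => exact aux
  | succ n ih =>
    have I := ih h.down
    obtain ⟨h0, ⟨u, hu, hu'⟩, ⟨k, hk, hk'⟩⟩ := h
    refine ⟨aux, ⟨fun i x ξ => (-1) * (u * (f⁻¹ * f⁻¹)) i x ξ, fun i x ξ => ?_, ?_⟩,
      ⟨fun i x ξ => (-1) * (k * (f⁻¹ * f⁻¹)) i x ξ, fun i x ξ => ?_, ?_⟩⟩
    · have h2 := (hfp i x ξ).ne'
      refine ((hu i x ξ).fun_inv h2).congr_deriv (Eq.symm ?_)
      change (-1) * (u i x ξ * ((f i x ξ)⁻¹ * (f i x ξ)⁻¹)) = _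
      field_simp
    · refine Sy.smul hp hq ((hu'.mul (I.mul I)).congr (fun _ _ _ => rfl) ?_) (fun _ => -1) 1 (by simp)
      intro i x ξ
      have := (hm i x ξ).ne'
      simp only [Pi.mul_apply, Pi.inv_apply]; field_simp
    · have h2 := (hfp i x ξ).ne'
      refine ((hk i x ξ).fun_inv h2).congr_deriv (Eq.symm ?_)
      change (-1) * (k i x ξ * ((f i x ξ)⁻¹ * (f i x ξ)⁻¹)) = _
      field_simp
    · refine Sy.smul hp hq ((hk'.mul (I.mul I)).congr (fun _ _ _ => rfl) ?_) (fun _ => -1) 1 (by simp)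
      intro i x ξ
      have := (hm i x ξ).ne'
      simp only [Pi.mul_apply, Pi.inv_apply]; field_simp

theorem Sy.sqrt {n : ℕ} {f : ι → ℝ → ℝ → ℝ}
    (hp : 0 ≤ p) (hq : 0 ≤ q) (h : Sy p q n f 1) (K : ℝ) (hK : 0 < K)
    (hf : ∀ i x ξ, 1 ≤ K * f i x ξ) : Sy p q n (fun i x ξ => Real.sqrt (f i x ξ)) 1 := by
  have hfp : ∀ i x ξ, 0 < f i x ξ := fun i x ξ =>
    pos_of_mul_pos_right (zero_lt_one.trans_le (hf i x ξ)) hK.le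
  have hinv := h.inv hp hq (by simp) K hK (by simpa using hf)
  have aux : ∃ C : ℝ, 0 ≤ C ∧ ∀ i x ξ, |Real.sqrt (f i x ξ)| ≤ C * (1 : ι → ℝ → ℝ → ℝ) i x ξ := by
    obtain ⟨C, hC, h⟩ := h.bd
    refine ⟨Real.sqrt C, Real.sqrt_nonneg _, fun i x ξ => ?_⟩
    rw [abs_of_nonneg (Real.sqrt_nonneg _)]
    simp only [Pi.one_apply, mul_one]
    apply Real.sqrt_le_sqrt
    have := h i x ξ
    simp only [Pi.one_apply, mul_one] at this
    exact (le_abs_self _).trans this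
  have key : ∀ i x ξ (d : ℝ), (1/2) * (d * (Real.sqrt (f i x ξ) * (f i x ξ)⁻¹)) =
      d / (2 * Real.sqrt (f i x ξ)) := by
    intro i x ξ d
    have h1 := Real.sqrt_pos.2 (hfp i x ξ)
    have h2 := Real.mul_self_sqrt (hfp i x ξ).le
    generalize Real.sqrt (f i x ξ) = r at *
    rw [← h2]; field_simp
  induction n with
  | zero => exact aux
  | succ n ih =>
    have I := ih h.down hinv.down
    have J := hinv.down
    obtain ⟨h0, ⟨u, hu, hu'⟩, ⟨k, hk, hk'⟩⟩ := h
    refine ⟨aux, ⟨fun i x ξ => (1/2) * (u * ((fun i x ξ => Real.sqrt (f i x ξ)) * f⁻¹)) i x ξ,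
        fun i x ξ => ?_, ?_⟩,
      ⟨fun i x ξ => (1/2) * (k * ((fun i x ξ => Real.sqrt (f i x ξ)) * f⁻¹)) i x ξ,
        fun i x ξ => ?_, ?_⟩⟩
    · have h2 := (hfp i x ξ).ne'
      convert (hu i x ξ).sqrt h2 using 1
      exact key i x ξ _
    · refine Sy.smul hp hq ((hu'.mul (I.mul J)).congr (fun _ _ _ => rfl) ?_) (fun _ => 1/2) (|1/2|)
        (fun _ => le_rfl)
      intro i x ξ
      simp
    · have h2 := (hfp i x ξ).ne'
      convert (hk i x ξ).sqrt h2 using 1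
      exact key i x ξ _
    · refine Sy.smul hp hq ((hk'.mul (I.mul J)).congr (fun _ _ _ => rfl) ?_) (fun _ => 1/2) (|1/2|)
        (fun _ => le_rfl)
      intro i x ξ
      simp

theorem Sy.itx {k : ℕ} {f m : ι → ℝ → ℝ → ℝ} (h : Sy p q k f m) :
    ∃ C : ℝ, 0 ≤ C ∧ ∀ i x ξ, |iteratedDeriv k (fun y => f i y ξ) x| ≤
      C * (m i x ξ * p i x ξ ^ k) := by
  induction k generalizing f m with
  | zero => simpa using h.bd
  | succ k ih =>
    obtain ⟨h0, ⟨u, hu, hu'⟩, -⟩ := h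
    obtain ⟨C, hC, h⟩ := ih hu'
    refine ⟨C, hC, fun i x ξ => ?_⟩
    rw [iteratedDeriv_succ']
    have : deriv (fun y => f i y ξ) = fun y => u i y ξ := by
      funext y; exact (hu i y ξ).deriv
    rw [this]
    convert h i x ξ using 2
    simp only [Pi.mul_apply]; ring

theorem Sy.itxi {k l : ℕ} {f m : ι → ℝ → ℝ → ℝ} (h : Sy p q (k+l) f m) :
    ∃ g, (∀ i x ξ, iteratedDeriv l (f i x) ξ = g i x ξ) ∧ Sy p q k g (m * q ^ l) := by
  induction l generalizing f m with
  | zero => exact ⟨f, fun i x ξ => by simp, by simpa using h⟩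
  | succ l ih =>
    obtain ⟨h0, -, ⟨u, hu, hu'⟩⟩ := h
    obtain ⟨g, hg, hs⟩ := ih hu'
    refine ⟨g, fun i x ξ => ?_, ?_⟩
    · rw [iteratedDeriv_succ', ← hg]
      congr 1
      funext y; exact (hu i x y).deriv
    · refine hs.congr (fun _ _ _ => rfl) ?_
      intro i x ξ
      simp only [Pi.mul_apply, Pi.pow_apply]; ring

theorem Sy.pd {k l : ℕ} {f m : ι → ℝ → ℝ → ℝ} (h : Sy p q (k+l) f m) :
    ∃ C : ℝ, 0 ≤ C ∧ ∀ i x ξ, |pdXxi k l (f i) x ξ| ≤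
      C * (m i x ξ * q i x ξ ^ l * p i x ξ ^ k) := by
  obtain ⟨g, hg, hs⟩ := h.itxi
  obtain ⟨C, hC, h⟩ := hs.itx
  refine ⟨C, hC, fun i x ξ => ?_⟩
  have : (fun x' => iteratedDeriv l (f i x') ξ) = fun y => g i y ξ := by
    funext y; exact hg i y ξ
  rw [pdXxi, this]
  exact h i x ξ

end

/-- Glaeser's inequality. -/
theorem glaeser (a : ℝ → ℝ) (ha : ContDiff ℝ ∞ a) (ha0 : ∀ x, 0 ≤ a x) (K : ℝ)
    (hK : ∀ x, |iteratedDeriv 2 a x| ≤ K) (x : ℝ) : |deriv a x| ≤ 2 * Real.sqrt K * Real.sqrt (a x) := by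
  have hK0 : 0 ≤ K := (abs_nonneg _).trans (hK 0)
  have d1 : Differentiable ℝ a := ha.differentiable (by simp)
  have d2 : Differentiable ℝ (deriv a) := by
    have := ha.differentiable_iteratedDeriv 1 (by exact_mod_cast (WithTop.coe_lt_top (1:ℕ)))
    simpa [iteratedDeriv_one] using this
  have l1 : ∀ y z, |deriv a y - deriv a z| ≤ K * |y - z| := by
    intro y z
    have := Convex.norm_image_sub_le_of_norm_deriv_le (f := deriv a) (C := K) (s := univ)
      (fun x _ => d2 x) (fun x _ => ?_) convex_univ (mem_univ z) (mem_univ y)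
    · simpa using this
    · have := hK x
      rw [iteratedDeriv_succ, iteratedDeriv_one] at this
      exact this
  have l2 : ∀ h, 0 ≤ K * (h * h) + deriv a x * h + a x := by
    intro h
    have := Convex.norm_image_sub_le_of_norm_hasDerivWithin_le (f := fun y => a y - deriv a x * y)
      (f' := fun y => deriv a y - deriv a x * 1)
      (C := K * |h|) (s := Metric.closedBall x |h|) (x := x) (y := x + h)
      (fun y _ => ((d1 y).hasDerivAt.sub ((hasDerivAt_id y).const_mul _)).hasDerivWithinAt)
      (fun y hy => ?_) (convex_closedBall _ _) (by simp) (by simp)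
    · have h2 := ha0 (x + h)
      have h3 := (le_abs_self _).trans this
      have h4 : ‖x + h - x‖ = |h| := by simp
      rw [h4, mul_assoc, abs_mul_abs_self] at h3
      nlinarith
    · have := l1 y x
      simp only [mul_one, Real.norm_eq_abs]
      refine this.trans (mul_le_mul_of_nonneg_left ?_ hK0)
      simpa [Real.dist_eq] using hy
  have l3 := discrim_le_zero l2
  rw [discrim] at l3
  apply abs_le_of_sq_le_sq ?_ (by positivity)
  rw [mul_pow, mul_pow, Real.sq_sqrt hK0, Real.sq_sqrt (ha0 x)]
  linarith

theorem br_ge {μ : ℝ} (h0 : 0 < μ) (h1 : μ ≤ 1) (ξ : ℝ) : 1 ≤ br μ ξ := by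
  rw [br, Real.one_le_sqrt]
  have : 1 ≤ μ⁻¹ := (one_le_inv₀ h0).2 h1
  nlinarith [sq_nonneg ξ]

theorem br_sq {μ : ℝ} (ξ : ℝ) : br μ ξ ^ 2 = μ⁻¹ ^ 2 + ξ ^ 2 := by
  rw [br, Real.sq_sqrt (by positivity)]

theorem br_deriv {μ : ℝ} (h0 : 0 < μ) (h1 : μ ≤ 1) (ξ : ℝ) :
    HasDerivAt (br μ) (ξ / br μ ξ) ξ := by
  have hb : 0 < br μ ξ := zero_lt_one.trans_le (br_ge h0 h1 ξ)
  have h : HasDerivAt (fun y : ℝ => μ⁻¹ ^ 2 + y ^ 2) (2 * ξ) ξ := by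
    simpa using (hasDerivAt_pow 2 ξ).const_add (μ⁻¹ ^ 2)
  have h2 := h.sqrt (by rw [← br_sq]; positivity)
  refine h2.congr_deriv ?_
  change 2 * ξ / (2 * br μ ξ) = _
  field_simp

section
variable {ι : Type} {p q : ι → ℝ → ℝ → ℝ}

/-- The pair `r = ξ/⟨ξ⟩²`, `v = 1/⟨ξ⟩²`. -/
theorem Sy_rv (hp : 0 ≤ p) (μ : ι → ℝ) (hμ : ∀ i, 0 < μ i) (hμ1 : ∀ i, μ i ≤ 1)
    (hqd : ∀ i x ξ, q i x ξ = (br (μ i) ξ)⁻¹) (n : ℕ) :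
    Sy p q n (fun i _ ξ => ξ / br (μ i) ξ ^ 2) q ∧
    Sy p q n (fun i _ ξ => 1 / br (μ i) ξ ^ 2) (q * q) := by
  have hbp : ∀ i ξ, 0 < br (μ i) ξ := fun i ξ => zero_lt_one.trans_le (br_ge (hμ i) (hμ1 i) ξ)
  have hq : 0 ≤ q := fun i x ξ => by
    rw [hqd]; exact (inv_pos.2 (hbp i ξ)).le
  have b1 : ∃ C : ℝ, 0 ≤ C ∧ ∀ i x ξ, |(fun (i : ι) (_ : ℝ) (ξ : ℝ) => ξ / br (μ i) ξ ^ 2) i x ξ|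
      ≤ C * q i x ξ := by
    refine ⟨1, zero_le_one, fun i x ξ => ?_⟩
    have h := hbp i ξ
    have h2 : |ξ| ≤ br (μ i) ξ := by
      apply Real.abs_le_sqrt
      nlinarith [sq_nonneg ((μ i)⁻¹)]
    rw [hqd, one_mul, abs_div, abs_of_pos (by positivity : 0 < br (μ i) ξ ^ 2),
      div_le_iff₀ (by positivity)]
    calc |ξ| ≤ br (μ i) ξ := h2
      _ = _ := by field_simp
  have b2 : ∃ C : ℝ, 0 ≤ C ∧ ∀ i x ξ, |(fun (i : ι) (_ : ℝ) (ξ : ℝ) => 1 / br (μ i) ξ ^ 2) i x ξ|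
      ≤ C * (q * q) i x ξ := by
    refine ⟨1, zero_le_one, fun i x ξ => ?_⟩
    have h := hbp i ξ
    simp only [Pi.mul_apply]
    rw [hqd, one_mul, abs_of_pos (by positivity)]
    apply le_of_eq; field_simp
  induction n with
  | zero => exact ⟨b1, b2⟩
  | succ n ih =>
    obtain ⟨hr, hv⟩ := ih
    constructor
    · refine ⟨b1, ⟨0, fun i x ξ => hasDerivAt_const x _, Sy.zero hp hq (mul_nonneg hq hp)⟩,
        ⟨_, fun i x ξ => ?_, hv.add (Sy.smul hp hq (hr.mul hr) (fun _ => -2) (|-2|) (fun _ => le_rfl))⟩⟩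
      have h := hbp i ξ
      refine ((hasDerivAt_id ξ).div ((br_deriv (hμ i) (hμ1 i) ξ).pow 2) (pow_pos h 2).ne').congr_deriv ?_
      simp only [Pi.add_apply, Pi.mul_apply, Pi.pow_apply, id]
      field_simp
      push_cast
      ring
    · refine ⟨b2, ⟨0, fun i x ξ => hasDerivAt_const x _,
          Sy.zero hp hq (mul_nonneg (mul_nonneg hq hq) hp)⟩,
        ⟨fun i x ξ => (-2) * (ξ / br (μ i) ξ ^ 2 * (1 / br (μ i) ξ ^ 2)), fun i x ξ => ?_,
          (Sy.smul hp hq (hr.mul hv) (fun _ => -2) (|-2|)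
          (fun _ => le_rfl)).congr (fun _ _ _ => rfl) ?_⟩⟩
      · have h := hbp i ξ
        refine ((hasDerivAt_const ξ (1:ℝ)).div ((br_deriv (hμ i) (hμ1 i) ξ).pow 2)
          (pow_pos h 2).ne').congr_deriv ?_
        simp only [Pi.mul_apply, Pi.pow_apply]
        field_simp
        push_cast
        ring
      · intro i x ξ; simp only [Pi.mul_apply]; ring

theorem Sy_w (hp : 0 ≤ p) (δ : ℝ) (μ : ι → ℝ) (hμ : ∀ i, 0 < μ i) (hμ1 : ∀ i, μ i ≤ 1)
    (hqd : ∀ i x ξ, q i x ξ = (br (μ i) ξ)⁻¹) (n : ℕ) :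
    Sy p q n (fun i _ ξ => br (μ i) ξ ^ (-(2*δ))) (fun i _ ξ => br (μ i) ξ ^ (-(2*δ))) := by
  have hbp : ∀ i ξ, 0 < br (μ i) ξ := fun i ξ => zero_lt_one.trans_le (br_ge (hμ i) (hμ1 i) ξ)
  have hq : 0 ≤ q := fun i x ξ => by
    rw [hqd]; exact (inv_pos.2 (hbp i ξ)).le
  have b1 : ∃ C : ℝ, 0 ≤ C ∧ ∀ i x ξ,
      |(fun (i : ι) (_ : ℝ) (ξ : ℝ) => br (μ i) ξ ^ (-(2*δ))) i x ξ|
      ≤ C * (fun (i : ι) (_ : ℝ) (ξ : ℝ) => br (μ i) ξ ^ (-(2*δ))) i x ξ := by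
    refine ⟨1, zero_le_one, fun i x ξ => ?_⟩
    rw [one_mul, abs_of_pos (Real.rpow_pos_of_pos (hbp i ξ) _)]
  induction n with
  | zero => exact b1
  | succ n ih =>
    refine ⟨b1, ⟨0, fun i x ξ => hasDerivAt_const x _, Sy.zero hp hq (mul_nonneg ?_ hp)⟩,
        ⟨_, fun i x ξ => ?_, (Sy.smul hp hq (ih.mul (Sy_rv hp μ hμ hμ1 hqd n).1)
          (fun _ => -(2*δ)) (|-(2*δ)|) (fun _ => le_rfl))⟩⟩
    · intro i x ξ; exact (Real.rpow_pos_of_pos (hbp i ξ) _).le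
    · have h := hbp i ξ
      refine ((br_deriv (hμ i) (hμ1 i) ξ).rpow_const (p := -(2*δ)) (Or.inl h.ne')).congr_deriv ?_
      simp only [Pi.mul_apply]
      rw [Real.rpow_sub_one h.ne']
      field_simp

theorem Sy_a (hq : 0 ≤ q) (a : ℝ → ℝ) (ha : ContDiff ℝ ∞ a) (ha0 : ∀ x, 0 ≤ a x)
    (c : ℕ → ℝ) (hc : ∀ k x, |iteratedDeriv k a x| ≤ c k) (Φ : ι → ℝ → ℝ → ℝ) (B : ℝ)
    (hΦ : ∀ i x ξ, 0 < Φ i x ξ) (hΦB : ∀ i x ξ, Φ i x ξ ≤ B) (haΦ : ∀ i x ξ, a x ≤ Φ i x ξ)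
    (hpd : ∀ i x ξ, p i x ξ = (Real.sqrt (Φ i x ξ))⁻¹) (n k : ℕ) :
    Sy p q n (fun _ x _ => iteratedDeriv k a x) (Φ * p ^ k) := by
  have hsp : ∀ i x ξ, 0 < Real.sqrt (Φ i x ξ) := fun i x ξ => Real.sqrt_pos.2 (hΦ i x ξ)
  have hp : 0 ≤ p := fun i x ξ => by
    rw [hpd]; exact (inv_pos.2 (hsp i x ξ)).le
  have b1 : ∀ k, ∃ C : ℝ, 0 ≤ C ∧ ∀ i x ξ,
      |(fun (_ : ι) (x : ℝ) (_ : ℝ) => iteratedDeriv k a x) i x ξ| ≤ C * (Φ * p ^ k) i x ξ := by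
    intro k
    match k with
    | 0 =>
      refine ⟨1, zero_le_one, fun i x ξ => ?_⟩
      simpa [abs_of_nonneg (ha0 x)] using haΦ i x ξ
    | 1 =>
      refine ⟨2 * Real.sqrt (c 2), by positivity, fun i x ξ => ?_⟩
      have h := glaeser a ha ha0 (c 2) (hc 2) x
      have h2 : (Φ * p ^ 1) i x ξ = Real.sqrt (Φ i x ξ) := by
        simp only [Pi.mul_apply, pow_one, hpd]
        have := hsp i x ξ
        nth_rw 1 [← Real.mul_self_sqrt (hΦ i x ξ).le]
        field_simp
      rw [h2]
      simp only [iteratedDeriv_one]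
      exact h.trans (mul_le_mul_of_nonneg_left (Real.sqrt_le_sqrt (haΦ i x ξ)) (by positivity))
    | k+2 =>
      have hc0 : 0 ≤ c (k+2) := (abs_nonneg _).trans (hc (k+2) 0)
      refine ⟨c (k+2) * Real.sqrt B ^ k, by positivity, fun i x ξ => (hc (k+2) x).trans ?_⟩
      have h2 : (Φ * p ^ (k+2)) i x ξ = (Real.sqrt (Φ i x ξ) ^ k)⁻¹ := by
        simp only [Pi.mul_apply, Pi.pow_apply, hpd, inv_pow]
        have := hsp i x ξ
        nth_rw 1 [← Real.mul_self_sqrt (hΦ i x ξ).le]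
        field_simp
        ring
      have h3 := hsp i x ξ
      rw [h2, mul_assoc]
      apply le_mul_of_one_le_right hc0
      rw [← div_eq_mul_inv, one_le_div (by positivity)]
      exact pow_le_pow_left₀ h3.le (Real.sqrt_le_sqrt (hΦB i x ξ)) _
  have hm : ∀ k, 0 ≤ Φ * p ^ k := fun k i x ξ =>
    mul_nonneg (hΦ i x ξ).le (pow_nonneg (hp i x ξ) k)
  induction n generalizing k with
  | zero => exact b1 k
  | succ n ih =>
    refine ⟨b1 k, ⟨_, fun i x ξ => ?_, (ih (k+1)).congr (fun _ _ _ => rfl) ?_⟩,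
      ⟨0, fun i x ξ => hasDerivAt_const ξ _, Sy.zero hp hq (mul_nonneg (hm k) hq)⟩⟩
    · have := ha.differentiable_iteratedDeriv k (by exact_mod_cast (WithTop.coe_lt_top (k:ℕ)))
      rw [iteratedDeriv_succ]
      exact (this x).hasDerivAt
    · intro i x ξ; simp only [Pi.mul_apply, Pi.pow_apply]; ring

end

theorem stmt18 (T : ℝ) (hT : 0 < T)
    (b : ℝ → ℝ) (hb : ContDiffOn ℝ 1 b (Icc 0 T)) (hb0 : ∀ t ∈ Icc (0:ℝ) T, 0 ≤ b t)
    (hbbd : ∃ M : ℝ, ∀ t ∈ Icc (0:ℝ) T, b t ≤ M)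
    (s δ : ℝ) (hs : 1 < s) (hδ0 : 0 ≤ δ) (hδ1 : δ < 1)
    (a : ℝ → ℝ) (ha : Gevrey s a) (ha0 : ∀ x, 0 ≤ a x) :
    ∀ k l : ℕ, ∃ C : ℝ, 0 < C ∧
      ∀ (μ t x ξ : ℝ), 0 < μ → μ ≤ 1 → t ∈ Icc (0:ℝ) T →
        derivWithin b (Icc 0 T) t ≠ 0 →
        |pdXxi k l
            (fun x' ξ' => Real.sqrt
              (|derivWithin b (Icc 0 T) t|⁻¹ * (phi a δ μ x' ξ')⁻¹ * Ffun b a T δ μ t x' ξ' /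
                (b t * phi a δ μ x' ξ' + br μ ξ' ^ (-(2*δ))))) x ξ| ≤
          C * phi a δ μ x ξ ^ (-(k : ℝ)/2) * br μ ξ ^ (-(l : ℝ)) := by
  intro k l
  obtain ⟨M₀, hM₀⟩ := hbbd
  obtain ⟨M, hM0, hM⟩ : ∃ M : ℝ, 0 ≤ M ∧ ∀ t ∈ Icc (0:ℝ) T, b t ≤ M :=
    ⟨max M₀ 0, le_max_right _ _, fun t ht => (hM₀ t ht).trans (le_max_left _ _)⟩
  obtain ⟨hac, C₀, A₀, hC₀, hA₀, hG⟩ := ha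
  let ι : Type := {z : ℝ × ℝ // 0 < z.1 ∧ z.1 ≤ 1 ∧ z.2 ∈ Icc (0:ℝ) T ∧
    derivWithin b (Icc 0 T) z.2 ≠ 0}
  let μ : ι → ℝ := fun i => i.1.1
  let β : ι → ℝ := fun i => b i.1.2
  let ε : ι → ℝ := fun i =>
    |derivWithin b (Icc 0 T) i.1.2|⁻¹ * derivWithin b (Icc 0 T) i.1.2
  have hμ : ∀ i, 0 < μ i := fun i => i.2.1
  have hμ1 : ∀ i, μ i ≤ 1 := fun i => i.2.2.1
  have hβ : ∀ i, 0 ≤ β i := fun i => hb0 _ i.2.2.2.1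
  have hβM : ∀ i, β i ≤ M := fun i => hM _ i.2.2.2.1
  have hε : ∀ i, |ε i| ≤ 1 := fun i => by
    simp only [ε]
    rw [abs_mul, abs_inv, abs_abs, inv_mul_cancel₀ (abs_ne_zero.2 i.2.2.2.2)]
  let w : ι → ℝ → ℝ → ℝ := fun i _ ξ => br (μ i) ξ ^ (-(2*δ))
  let Φ : ι → ℝ → ℝ → ℝ := fun i x ξ => phi a δ (μ i) x ξ
  let A : ι → ℝ → ℝ → ℝ := fun i x ξ => a x
  let p : ι → ℝ → ℝ → ℝ := fun i x ξ => (Real.sqrt (Φ i x ξ))⁻¹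
  let q : ι → ℝ → ℝ → ℝ := fun i x ξ => (br (μ i) ξ)⁻¹
  let Bt : ι → ℝ → ℝ → ℝ := fun i _ _ => β i
  let D : ι → ℝ → ℝ → ℝ := Bt * Φ + w
  have hbp : ∀ i ξ, 0 < br (μ i) ξ := fun i ξ => zero_lt_one.trans_le (br_ge (hμ i) (hμ1 i) ξ)
  have hw : ∀ i x ξ, 0 < w i x ξ := fun i x ξ => Real.rpow_pos_of_pos (hbp i ξ) _
  have hw1 : ∀ i x ξ, w i x ξ ≤ 1 := fun i x ξ =>
    Real.rpow_le_one_of_one_le_of_nonpos (br_ge (hμ i) (hμ1 i) ξ) (by linarith)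
  have hΦe : ∀ i x ξ, Φ i x ξ = A i x ξ + w i x ξ := fun i x ξ => rfl
  have hA : ∀ i x ξ, 0 ≤ A i x ξ := fun i x ξ => ha0 x
  have hΦ : ∀ i x ξ, 0 < Φ i x ξ := fun i x ξ => add_pos_of_nonneg_of_pos (hA i x ξ) (hw i x ξ)
  have hD : ∀ i x ξ, 0 < D i x ξ := fun i x ξ =>
    add_pos_of_nonneg_of_pos (mul_nonneg (hβ i) (hΦ i x ξ).le) (hw i x ξ)
  have hp : 0 ≤ p := fun i x ξ => inv_nonneg.2 (Real.sqrt_nonneg _)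
  have hq : 0 ≤ q := fun i x ξ => inv_nonneg.2 (Real.sqrt_nonneg _)
  have Sw : ∀ n, Sy p q n w w := fun n => Sy_w hp δ μ hμ hμ1 (fun _ _ _ => rfl) n
  have SA : ∀ n, Sy p q n A Φ := fun n => by
    have := Sy_a (p := p) hq a hac ha0 (fun k => C₀ * A₀ ^ k * (k.factorial : ℝ) ^ s)
      (fun k x => hG x k) Φ (C₀ + 1) hΦ ?_ ?_ (fun _ _ _ => rfl) n 0
    · exact this.congr (fun i x ξ => by simp [A]) (fun i x ξ => by simp)
    · intro i x ξ
      have h1 := hG x 0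
      simp at h1
      exact add_le_add ((le_abs_self _).trans h1) (hw1 i x ξ)
    · intro i x ξ
      rw [hΦe]; exact le_add_of_nonneg_right (hw i x ξ).le
  have wΦ : ∀ i x ξ, w i x ξ ≤ 1 * Φ i x ξ := fun i x ξ => by
    rw [hΦe, one_mul]; exact le_add_of_nonneg_left (hA i x ξ)
  have SΦ : ∀ n, Sy p q n Φ Φ := fun n => (SA n).add ((Sw n).mono hp hq 1 zero_le_one wΦ)
  have SB : ∀ n, Sy p q n Bt Bt := fun n =>
    Sy.const hp hq (fun i x ξ => hβ i) β 1 zero_le_one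
      (fun i x ξ => by rw [abs_of_nonneg (hβ i), one_mul])
  have wD : ∀ i x ξ, w i x ξ ≤ 1 * D i x ξ := fun i x ξ => by
    rw [one_mul]; exact le_add_of_nonneg_left (mul_nonneg (hβ i) (hΦ i x ξ).le)
  have BD : ∀ i x ξ, (Bt * Φ) i x ξ ≤ 1 * D i x ξ := fun i x ξ => by
    rw [one_mul]; exact le_add_of_nonneg_right (hw i x ξ).le
  have SwD : ∀ n, Sy p q n w D := fun n => (Sw n).mono hp hq 1 zero_le_one wD
  have SD : ∀ n, Sy p q n D D := fun n =>
    (((SB n).mul (SΦ n)).mono hp hq 1 zero_le_one BD).add (SwD n)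
  have SBA : ∀ n, Sy p q n (Bt * A) D := fun n =>
    ((SB n).mul (SA n)).mono hp hq 1 zero_le_one BD
  -- the numerator
  let N : ι → ℝ → ℝ → ℝ := fun i x ξ =>
    2 * (Φ * (Bt * A + w)) i x ξ + (-ε i) * (Φ * (Bt * A) + A * w) i x ξ
  have SN : ∀ n, Sy p q n N (Φ * D) := fun n => by
    have h1 : Sy p q n (Φ * (Bt * A + w)) (Φ * D) := (SΦ n).mul ((SBA n).add (SwD n))
    have h2 : Sy p q n (Φ * (Bt * A) + A * w) (Φ * D) :=
      ((SΦ n).mul (SBA n)).add ((SA n).mul (SwD n))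
    exact (Sy.smul hp hq h1 (fun _ => 2) |2| (fun _ => le_rfl)).add
      (Sy.smul hp hq h2 (fun i => -ε i) 1 (fun i => by rw [abs_neg]; exact hε i))
  have SG : ∀ n, Sy p q n (N * (Φ⁻¹ * D⁻¹)) 1 := fun n => by
    have h1 := (SΦ n).inv hp hq hΦ 1 one_pos (fun i x ξ => by rw [one_mul])
    have h2 := (SD n).inv hp hq hD 1 one_pos (fun i x ξ => by rw [one_mul])
    refine ((SN n).mul (h1.mul h2)).congr (fun _ _ _ => rfl) ?_
    intro i x ξ
    have := (hΦ i x ξ).ne'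
    have := (hD i x ξ).ne'
    simp only [Pi.mul_apply, Pi.inv_apply, Pi.one_apply]
    field_simp
  have hlow : ∀ i x ξ, 1 ≤ (M + 1) * (N * (Φ⁻¹ * D⁻¹)) i x ξ := by
    intro i x ξ
    have h1 := hΦ i x ξ
    have h2 := hD i x ξ
    have e1 : (M + 1) * (N * (Φ⁻¹ * D⁻¹)) i x ξ = ((M+1) * N i x ξ) / (Φ i x ξ * D i x ξ) := by
      simp only [Pi.mul_apply, Pi.inv_apply]
      field_simp
    rw [e1, one_le_div (by positivity)]
    have eN : N i x ξ = 2 * (Φ i x ξ * (β i * A i x ξ + w i x ξ)) +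
      (-ε i) * (Φ i x ξ * (β i * A i x ξ) + A i x ξ * w i x ξ) := rfl
    have eD : D i x ξ = β i * Φ i x ξ + w i x ξ := rfl
    have h3 := hA i x ξ
    have h4 := hw i x ξ
    have h5 := hβ i
    have h6 := hβM i
    have h7 := (abs_le.1 (hε i)).2
    have h8 := hΦe i x ξ
    rw [eN, eD]
    generalize Φ i x ξ = f at *
    generalize A i x ξ = α at *
    generalize w i x ξ = ww at *
    generalize β i = c at *
    generalize ε i = e at *
    have k1 : f * (c * α + ww) ≤ 2 * (f * (c * α + ww)) + (-e) * (f * (c * α) + α * ww) := by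
      have k2 : 0 ≤ f * (c * α) + α * ww := by positivity
      have k3 : e * (f * (c * α) + α * ww) ≤ 1 * (f * (c * α) + α * ww) :=
        mul_le_mul_of_nonneg_right h7 k2
      have k4 : α * ww ≤ f * ww := mul_le_mul_of_nonneg_right (by linarith) h4.le
      linarith
    have k5 : c * f + ww ≤ (M + 1) * (c * α + ww) := by
      have : c * ww ≤ M * ww := mul_le_mul_of_nonneg_right h6 h4.le
      have : 0 ≤ M * (c * α) := by positivity
      rw [h8]; linarith
    calc f * (c * f + ww) ≤ f * ((M + 1) * (c * α + ww)) := mul_le_mul_of_nonneg_left k5 h1.le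
      _ = (M + 1) * (f * (c * α + ww)) := by ring
      _ ≤ _ := mul_le_mul_of_nonneg_left k1 (by linarith)
  have SS := (SG (k + l)).sqrt hp hq (M + 1) (by linarith) hlow
  obtain ⟨C, hC, hfin⟩ := SS.pd
  refine ⟨C + 1, by linarith, ?_⟩
  intro m t x ξ hm0 hm1 ht hbt
  let i : ι := ⟨(m, t), hm0, hm1, ht, hbt⟩
  have h := hfin i x ξ
  have e1 : (fun x' ξ' => Real.sqrt
              (|derivWithin b (Icc 0 T) t|⁻¹ * (phi a δ m x' ξ')⁻¹ * Ffun b a T δ m t x' ξ' /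
                (b t * phi a δ m x' ξ' + br m ξ' ^ (-(2*δ))))) =
      fun x' ξ' => Real.sqrt ((N * (Φ⁻¹ * D⁻¹)) i x' ξ') := by
    funext x' ξ'
    congr 1
    have eN : |derivWithin b (Icc 0 T) t|⁻¹ * Ffun b a T δ m t x' ξ' = N i x' ξ' := by
      have : |derivWithin b (Icc 0 T) t| ≠ 0 := abs_ne_zero.2 hbt
      change _ = 2 * (phi a δ m x' ξ' * (b t * a x' + br m ξ' ^ (-(2*δ)))) +
        (-(|derivWithin b (Icc 0 T) t|⁻¹ * derivWithin b (Icc 0 T) t)) *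
          (phi a δ m x' ξ' * (b t * a x') + a x' * br m ξ' ^ (-(2*δ)))
      rw [Ffun]
      field_simp
      ring
    change _ = N i x' ξ' * ((phi a δ m x' ξ')⁻¹ * (b t * phi a δ m x' ξ' + br m ξ' ^ (-(2*δ)))⁻¹)
    rw [← eN, div_eq_mul_inv]
    ring
  rw [e1]
  refine h.trans ?_
  have hφ : 0 < phi a δ m x ξ := hΦ i x ξ
  have hbr : 0 < br m ξ := hbp i ξ
  have e2 : p i x ξ ^ k = phi a δ m x ξ ^ (-(k : ℝ)/2) := by
    change (Real.sqrt (phi a δ m x ξ))⁻¹ ^ k = _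
    rw [Real.sqrt_eq_rpow, ← Real.rpow_neg hφ.le, ← Real.rpow_mul_natCast hφ.le]
    congr 1; ring
  have e3 : q i x ξ ^ l = br m ξ ^ (-(l : ℝ)) := by
    change (br m ξ)⁻¹ ^ l = _
    rw [Real.rpow_neg hbr.le, Real.rpow_natCast, inv_pow]
  rw [e2, e3]
  simp only [Pi.one_apply, one_mul]
  have e4 : 0 ≤ phi a δ m x ξ ^ (-(k : ℝ)/2) * br m ξ ^ (-(l : ℝ)) := by positivity
  nlinarith
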